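/- arXiv:0808.1585 — 2 statements merged into one kernel-verified Lean document; each statement's English description precedes it below -/
import Mathlib

section
/- Let R be an associative ring with unit and let (A, B) be a hereditary complete cotorsion pair in Mod R with kernel ω = A ∩ B. The following are equivalent: (a1) (A, B) is a tilting cotorsion pair, i.e. there is a tilting module T ∈ Mod R with B = T^⊥; (a2) pd_A(A) < ∞ and ω is closed under arbitrary direct sums; (a3) ω is closed under arbitrary direct sums, pd(ω) < ∞ and A ⊆ ω^∨. -/
noncomputable section

open CategoryTheory CategoryTheory.Limits Opposite DirectSum

universe u

namespace CotorsionDim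

variable {R : Type u} [Ring R]

/-- `Ext^n_R(M,N) = 0`. -/
def ExtZero (M N : ModuleCat.{u} R) (n : ℕ) : Prop :=
  IsZero (((Ext ℤ (ModuleCat.{u} R) n).obj (op M)).obj N)

/-- A pair of composable maps forms a short exact sequence `0 → A → B → C → 0`. -/
def IsSES {A B C : ModuleCat.{u} R} (f : A ⟶ B) (g : B ⟶ C) : Prop :=
  ∃ w : f ≫ g = 0, (CategoryTheory.ShortComplex.mk f g w).ShortExact

/-- relative projective dimension `pd_𝒳(M)` -/
def rpd (𝒳 : Set (ModuleCat.{u} R)) (M : ModuleCat.{u} R) : ℕ∞ :=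
  sInf {n : ℕ∞ | ∀ j : ℕ, n < (j : ℕ∞) → ∀ X ∈ 𝒳, ExtZero M X j}

/-- relative injective dimension `id_𝒳(M)` -/
def rid (𝒳 : Set (ModuleCat.{u} R)) (M : ModuleCat.{u} R) : ℕ∞ :=
  sInf {n : ℕ∞ | ∀ j : ℕ, n < (j : ℕ∞) → ∀ X ∈ 𝒳, ExtZero X M j}

/-- `pd_𝒳(𝒴)` -/
def rpdClass (𝒳 𝒴 : Set (ModuleCat.{u} R)) : ℕ∞ := ⨆ Y : 𝒴, rpd 𝒳 Y

/-- `id_𝒳(𝒴)` -/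
def ridClass (𝒳 𝒴 : Set (ModuleCat.{u} R)) : ℕ∞ := ⨆ Y : 𝒴, rid 𝒳 Y

/-- projective dimension -/
def pd (M : ModuleCat.{u} R) : ℕ∞ := rpd Set.univ M

/-- injective dimension -/
def idim (M : ModuleCat.{u} R) : ℕ∞ := rid Set.univ M

/-- `pd(𝒴)` -/
def pdClass (𝒴 : Set (ModuleCat.{u} R)) : ℕ∞ := ⨆ Y : 𝒴, pd Y.1

/-- `id(𝒴)` -/
def idClass (𝒴 : Set (ModuleCat.{u} R)) : ℕ∞ := ⨆ Y : 𝒴, idim Y.1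

/-- `M` has an `𝒳`-resolution `0 → X_n → ⋯ → X_0 → M → 0` of length `n`. -/
def HasResLen (𝒳 : Set (ModuleCat.{u} R)) : ℕ → ModuleCat.{u} R → Prop
  | 0, M => M ∈ 𝒳
  | n+1, M => ∃ (K X : ModuleCat.{u} R) (f : K ⟶ X) (g : X ⟶ M),
      X ∈ 𝒳 ∧ IsSES f g ∧ HasResLen 𝒳 n K

/-- `M` has an `𝒳`-coresolution `0 → M → X_0 → ⋯ → X_n → 0` of length `n`. -/
def HasCoresLen (𝒳 : Set (ModuleCat.{u} R)) : ℕ → ModuleCat.{u} R → Prop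
  | 0, M => M ∈ 𝒳
  | n+1, M => ∃ (X C : ModuleCat.{u} R) (f : M ⟶ X) (g : X ⟶ C),
      X ∈ 𝒳 ∧ IsSES f g ∧ HasCoresLen 𝒳 n C

/-- `resdim_𝒳(M)` -/
def resdim (𝒳 : Set (ModuleCat.{u} R)) (M : ModuleCat.{u} R) : ℕ∞ :=
  ⨅ n : {n : ℕ // HasResLen 𝒳 n M}, (n : ℕ∞)

/-- `coresdim_𝒳(M)` -/
def coresdim (𝒳 : Set (ModuleCat.{u} R)) (M : ModuleCat.{u} R) : ℕ∞ :=
  ⨅ n : {n : ℕ // HasCoresLen 𝒳 n M}, (n : ℕ∞)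

/-- `resdim_𝒳(𝒴)` -/
def resdimClass (𝒳 𝒴 : Set (ModuleCat.{u} R)) : ℕ∞ := ⨆ Y : 𝒴, resdim 𝒳 Y

/-- `coresdim_𝒳(𝒴)` -/
def coresdimClass (𝒳 𝒴 : Set (ModuleCat.{u} R)) : ℕ∞ := ⨆ Y : 𝒴, coresdim 𝒳 Y

/-- `𝒳^∧`, the class of modules with a finite `𝒳`-resolution. -/
def resClosure (𝒳 : Set (ModuleCat.{u} R)) : Set (ModuleCat.{u} R) :=
  {M | ∃ n, HasResLen 𝒳 n M}

/-- `𝒳^∨`, the class of modules with a finite `𝒳`-coresolution. -/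
def coresClosure (𝒳 : Set (ModuleCat.{u} R)) : Set (ModuleCat.{u} R) :=
  {M | ∃ n, HasCoresLen 𝒳 n M}

/-- `(𝒜, ℬ)` is a cotorsion pair. -/
def IsCotorsionPair (𝒜 ℬ : Set (ModuleCat.{u} R)) : Prop :=
  (∀ M, M ∈ 𝒜 ↔ ∀ B ∈ ℬ, ExtZero M B 1) ∧
  (∀ M, M ∈ ℬ ↔ ∀ A ∈ 𝒜, ExtZero A M 1)

/-- completeness of a cotorsion pair -/
def IsComplete (𝒜 ℬ : Set (ModuleCat.{u} R)) : Prop :=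
  ∀ M : ModuleCat.{u} R,
    (∃ (B A : ModuleCat.{u} R) (f : B ⟶ A) (g : A ⟶ M), B ∈ ℬ ∧ A ∈ 𝒜 ∧ IsSES f g) ∧
    (∃ (B A : ModuleCat.{u} R) (f : M ⟶ B) (g : B ⟶ A), B ∈ ℬ ∧ A ∈ 𝒜 ∧ IsSES f g)

/-- heredity of a cotorsion pair -/
def IsHereditary (𝒜 ℬ : Set (ModuleCat.{u} R)) : Prop :=
  ∀ i : ℕ, 1 ≤ i → ∀ A ∈ 𝒜, ∀ B ∈ ℬ, ExtZero A B i

variable (R)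

/-- `𝒫`, the class of modules of finite projective dimension. -/
def P : Set (ModuleCat.{u} R) := {M | pd M < ⊤}

variable {R}

/-- `M` admits a projective resolution consisting of finitely generated projectives,
i.e. `M ∈ mod R`. -/
def InmodR (M : ModuleCat.{u} R) : Prop :=
  ∃ K : ℕ → ModuleCat.{u} R, K 0 = M ∧ ∀ i : ℕ,
    ∃ (Q : ModuleCat.{u} R) (f : K (i+1) ⟶ Q) (g : Q ⟶ K i),
      Module.Finite R Q ∧ Projective Q ∧ IsSES f g

variable (R)

/-- `𝒫^{<∞} = 𝒫 ∩ mod R`. -/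
def Pfin : Set (ModuleCat.{u} R) := {M | pd M < ⊤ ∧ InmodR M}

/-- the big finitistic dimension -/
def bigFindim : ℕ∞ := pdClass (P R)

/-- the little finitistic dimension -/
def littleFindim : ℕ∞ := pdClass (Pfin R)

variable {R}

/-- `𝒳^{⊥₁}` -/
def rperp1 (𝒳 : Set (ModuleCat.{u} R)) : Set (ModuleCat.{u} R) :=
  {M | ∀ X ∈ 𝒳, ExtZero X M 1}

/-- `^{⊥₁}𝒳` -/
def lperp1 (𝒳 : Set (ModuleCat.{u} R)) : Set (ModuleCat.{u} R) :=
  {M | ∀ X ∈ 𝒳, ExtZero M X 1}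

/-- `T^⊥ = {M : Ext^i(T,M) = 0 for all i > 0}` -/
def rperpAll (T : ModuleCat.{u} R) : Set (ModuleCat.{u} R) :=
  {M | ∀ i : ℕ, 0 < i → ExtZero T M i}

/-- `Add T`: direct summands of arbitrary direct sums of copies of `T`. -/
def AddT (T : ModuleCat.{u} R) : Set (ModuleCat.{u} R) :=
  {M | ∃ (I : Type u) (s : M ⟶ ModuleCat.of R (I →₀ T)) (r : ModuleCat.of R (I →₀ T) ⟶ M),
    s ≫ r = 𝟙 M}

/-- `T` is a tilting module. -/
def IsTilting (T : ModuleCat.{u} R) : Prop :=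
  pd T < ⊤ ∧
  (∀ i : ℕ, 0 < i → ∀ I : Type u, ExtZero T (ModuleCat.of R (I →₀ T)) i) ∧
  ∃ n, HasCoresLen (AddT T) n (ModuleCat.of R R)


/-- `𝒳` is closed under arbitrary direct sums (coproducts). -/
def ClosedUnderCoproducts (𝒳 : Set (ModuleCat.{u} R)) : Prop :=
  ∀ (I : Type u) (f : I → ModuleCat.{u} R), (∀ i, f i ∈ 𝒳) →
    ModuleCat.of R (⨁ i, (f i : Type u)) ∈ 𝒳

/-- `𝒳` is closed under direct summands. -/
def ClosedUnderSummands (𝒳 : Set (ModuleCat.{u} R)) : Prop :=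
  ∀ (M N : ModuleCat.{u} R) (s : M ⟶ N) (r : N ⟶ M), s ≫ r = 𝟙 M → N ∈ 𝒳 → M ∈ 𝒳

/-! ### Vanishing of `Ext` via the derived category -/

lemma extZero_iff_subsingleton (M N : ModuleCat.{u} R) (n : ℕ) :
    ExtZero M N (n + 1) ↔ Subsingleton (Abelian.Ext M N (n + 1)) := by
  obtain ⟨Q⟩ := HasProjectiveResolution.out (Z := M)
  rw [ExtZero, (Q.isoExt (R := ℤ) (n + 1) N).isZero_iff,
    ← HomologicalComplex.exactAt_iff_isZero_homology,
    HomologicalComplex.exactAt_iff' _ n (n + 1) (n + 2) (by simp) (by simp),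
    ShortComplex.moduleCat_exact_iff]
  constructor
  · intro h
    refine subsingleton_of_forall_eq 0 fun α => ?_
    obtain ⟨f, hf, rfl⟩ := Q.extMk_surjective α (n + 2) rfl
    rw [Q.extMk_eq_zero_iff f (n + 2) rfl hf n rfl]
    exact h f hf
  · intro h f hf
    exact (Q.extMk_eq_zero_iff f (n + 2) rfl hf n rfl).1 (Subsingleton.elim _ _)

section LongExactSequences

variable {A B C X N : ModuleCat.{u} R} {f : A ⟶ B} {g : B ⟶ C}

lemma ExtZero.eq_zero {n : ℕ} (h : ExtZero X N (n + 1)) (x : Abelian.Ext X N (n + 1)) : x = 0 :=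
  have := (extZero_iff_subsingleton X N n).1 h
  Subsingleton.elim _ _

lemma extZero_of_forall {n : ℕ} (h : ∀ x : Abelian.Ext X N (n + 1), x = 0) :
    ExtZero X N (n + 1) :=
  (extZero_iff_subsingleton X N n).2 (subsingleton_of_forall_eq 0 h)

lemma extZero_of_projective [Projective X] (n : ℕ) : ExtZero X N (n + 1) :=
  isZero_Ext_succ_of_projective X N n

lemma extZero_of_injective [Injective N] (n : ℕ) : ExtZero X N (n + 1) :=
  extZero_of_forall fun x => x.eq_zero_of_injective

lemma ExtZero.of_retract_left {Y : ModuleCat.{u} R} {n : ℕ} (h : ExtZero Y N (n + 1))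
    (s : X ⟶ Y) (r : Y ⟶ X) (hsr : s ≫ r = 𝟙 X) : ExtZero X N (n + 1) :=
  extZero_of_forall fun x => by
    have : (Abelian.Ext.mk₀ s).comp ((Abelian.Ext.mk₀ r).comp x (zero_add _)) (zero_add _) = x := by
      simp [hsr]
    rw [← this, h.eq_zero ((Abelian.Ext.mk₀ r).comp x (zero_add _)), Abelian.Ext.comp_zero]

lemma ExtZero.of_retract_right {Y : ModuleCat.{u} R} {n : ℕ} (h : ExtZero N Y (n + 1))
    (s : X ⟶ Y) (r : Y ⟶ X) (hsr : s ≫ r = 𝟙 X) : ExtZero N X (n + 1) :=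
  extZero_of_forall fun x => by
    have : (x.comp (Abelian.Ext.mk₀ s) (add_zero _)).comp (Abelian.Ext.mk₀ r) (add_zero _) = x := by
      simp [hsr]
    rw [← this, h.eq_zero (x.comp (Abelian.Ext.mk₀ s) (add_zero _)), Abelian.Ext.zero_comp]

lemma IsSES.extZero_left₁ (h : IsSES f g) {n : ℕ} (hB : ExtZero B N (n + 1))
    (hC : ExtZero C N (n + 2)) : ExtZero A N (n + 1) := by
  obtain ⟨w, hS⟩ := h
  refine extZero_of_forall fun x => ?_
  obtain ⟨y, rfl⟩ := Abelian.Ext.contravariant_sequence_exact₁ hS N x (add_comm _ _)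
    (hC.eq_zero _)
  rw [hB.eq_zero y, Abelian.Ext.comp_zero]

lemma IsSES.extZero_left₂ (h : IsSES f g) {n : ℕ} (hA : ExtZero A N (n + 1))
    (hC : ExtZero C N (n + 1)) : ExtZero B N (n + 1) := by
  obtain ⟨w, hS⟩ := h
  refine extZero_of_forall fun x => ?_
  obtain ⟨y, rfl⟩ := Abelian.Ext.contravariant_sequence_exact₂ hS N x (hA.eq_zero _)
  rw [hC.eq_zero y, Abelian.Ext.comp_zero]

lemma IsSES.extZero_right₁ (h : IsSES f g) {n : ℕ} (hC : ExtZero X C (n + 1))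
    (hB : ExtZero X B (n + 2)) : ExtZero X A (n + 2) := by
  obtain ⟨w, hS⟩ := h
  refine extZero_of_forall fun x => ?_
  obtain ⟨y, rfl⟩ := Abelian.Ext.covariant_sequence_exact₁ X hS x (hB.eq_zero _) rfl
  rw [hC.eq_zero y, Abelian.Ext.zero_comp]

lemma IsSES.extZero_right₂ (h : IsSES f g) {n : ℕ} (hA : ExtZero X A (n + 1))
    (hC : ExtZero X C (n + 1)) : ExtZero X B (n + 1) := by
  obtain ⟨w, hS⟩ := h
  refine extZero_of_forall fun x => ?_
  obtain ⟨y, rfl⟩ := Abelian.Ext.covariant_sequence_exact₂ X hS x (hC.eq_zero _)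
  rw [hA.eq_zero y, Abelian.Ext.zero_comp]

lemma IsSES.extZero_right₃ (h : IsSES f g) {n : ℕ} (hB : ExtZero X B (n + 1))
    (hA : ExtZero X A (n + 2)) : ExtZero X C (n + 1) := by
  obtain ⟨w, hS⟩ := h
  refine extZero_of_forall fun x => ?_
  obtain ⟨y, rfl⟩ := Abelian.Ext.covariant_sequence_exact₃ X hS x rfl (hA.eq_zero _)
  rw [hB.eq_zero y, Abelian.Ext.zero_comp]

lemma IsSES.exists_extension (h : IsSES f g) (hC : ExtZero C N 1) (a : A ⟶ N) :
    ∃ b : B ⟶ N, f ≫ b = a := by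
  obtain ⟨w, hS⟩ := h
  obtain ⟨y, hy⟩ := Abelian.Ext.contravariant_sequence_exact₁ hS N (Abelian.Ext.mk₀ a)
    (add_comm 1 0) (hC.eq_zero _)
  obtain ⟨b, rfl⟩ := Abelian.Ext.mk₀_bijective _ _ |>.2 y
  exact ⟨b, (Abelian.Ext.mk₀_bijective _ _).1 (by simpa using hy)⟩

lemma IsSES.exists_lift (h : IsSES f g) (hA : ExtZero X A 1) (c : X ⟶ C) :
    ∃ b : X ⟶ B, b ≫ g = c := by
  obtain ⟨w, hS⟩ := h
  obtain ⟨y, hy⟩ := Abelian.Ext.covariant_sequence_exact₃ X hS (Abelian.Ext.mk₀ c)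
    (zero_add 1) (hA.eq_zero _)
  obtain ⟨b, rfl⟩ := Abelian.Ext.mk₀_bijective _ _ |>.2 y
  exact ⟨b, (Abelian.Ext.mk₀_bijective _ _).1 (by simpa using hy)⟩

lemma IsSES.extZero_one_of_lift (h : IsSES f g) (hB : ExtZero X B 1)
    (hl : ∀ c : X ⟶ C, ∃ b : X ⟶ B, b ≫ g = c) : ExtZero X A 1 := by
  obtain ⟨w, hS⟩ := h
  refine extZero_of_forall (n := 0) fun x => ?_
  obtain ⟨y, rfl⟩ := Abelian.Ext.covariant_sequence_exact₁ X hS x (hB.eq_zero _) rfl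
  obtain ⟨c, rfl⟩ := Abelian.Ext.mk₀_bijective _ _ |>.2 y
  obtain ⟨b, rfl⟩ := hl c
  rw [← Abelian.Ext.mk₀_comp_mk₀, Abelian.Ext.comp_assoc_of_second_deg_zero]
  simp [hS.comp_extClass]

end LongExactSequences

lemma exists_injective_ses (N : ModuleCat.{u} R) :
    ∃ (I C : ModuleCat.{u} R) (f : N ⟶ I) (g : I ⟶ C), Injective I ∧ IsSES f g :=
  ⟨_, _, Injective.ι N, cokernel.π (Injective.ι N), inferInstance, cokernel.condition _,
    ShortComplex.ShortExact.mk' (ShortComplex.exact_cokernel _) inferInstance inferInstance⟩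

lemma IsSES.of_exact {K M N : Type u} [AddCommGroup K] [Module R K] [AddCommGroup M]
    [Module R M] [AddCommGroup N] [Module R N] (f : K →ₗ[R] M) (g : M →ₗ[R] N)
    (hf : Function.Injective f) (hfg : Function.Exact f g) (hg : Function.Surjective g) :
    IsSES (ModuleCat.ofHom f) (ModuleCat.ofHom g) :=
  ⟨by ext x; exact hfg.apply_apply_eq_zero x,
    ShortComplex.ShortExact.mk'
      ((ShortComplex.ShortExact.moduleCat_exact_iff_function_exact _).2 hfg)
      ((ModuleCat.mono_iff_injective _).2 hf) ((ModuleCat.epi_iff_surjective _).2 hg)⟩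

/-! ### Coproducts -/

section Coproducts

variable {I : Type u} (A : I → ModuleCat.{u} R)

lemma extZero_directSum (n : ℕ) :
    ∀ N : ModuleCat.{u} R, (∀ i, ExtZero (A i) N (n + 1)) →
      ExtZero (ModuleCat.of R (⨁ i, (A i : Type u))) N (n + 1) := by
  classical
  induction n with
  | zero =>
    intro N h
    obtain ⟨E, C, f, g, hE, hS⟩ := exists_injective_ses N
    refine hS.extZero_one_of_lift (extZero_of_injective 0) fun c => ?_
    choose b hb using fun i =>
      hS.exists_lift (h i) (ModuleCat.ofHom (DirectSum.lof R I (fun i => (A i : Type u)) i) ≫ c)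
    refine ⟨ModuleCat.ofHom (DirectSum.toModule R I _ fun i => (b i).hom), ?_⟩
    ext : 1
    refine DirectSum.linearMap_ext R fun i => ?_
    ext x
    simpa using congr($(hb i) x)
  | succ n ih =>
    intro N h
    obtain ⟨E, C, f, g, hE, hS⟩ := exists_injective_ses N
    exact hS.extZero_right₁ (ih C fun i => hS.extZero_right₃ (extZero_of_injective n) (h i))
      (extZero_of_injective _)

lemma IsSES.directSum {K M N : I → ModuleCat.{u} R} {f : ∀ i, K i ⟶ M i} {g : ∀ i, M i ⟶ N i}
    (h : ∀ i, IsSES (f i) (g i)) :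
    IsSES (ModuleCat.ofHom (DirectSum.lmap fun i => (f i).hom))
      (ModuleCat.ofHom (DirectSum.lmap fun i => (g i).hom)) := by
  classical
  have hS (i : I) : (ShortComplex.mk (f i) (g i) (h i).choose).ShortExact := (h i).choose_spec
  have hex (i : I) : Function.Exact (f i).hom (g i).hom :=
    (ShortComplex.ShortExact.moduleCat_exact_iff_function_exact _).1 (hS i).exact
  have hinj (i : I) : Function.Injective (f i).hom := (hS i).moduleCat_injective_f
  refine IsSES.of_exact _ _ ((DirectSum.lmap_injective _).2 hinj) (fun y => ⟨fun hy => ?_, ?_⟩)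
    ((DirectSum.lmap_surjective _).2 fun i => (hS i).moduleCat_surjective_g)
  · have hy' (i : I) : ∃ x, (f i).hom x = y i :=
      (hex i (y i)).1 (by simpa using congr($hy i))
    choose x hx using hy'
    let z : Π₀ i, (K i : Type u) := DFinsupp.mk y.support fun i => x i
    refine ⟨z, DFinsupp.ext fun i => ?_⟩
    change (f i).hom (z i) = y i
    simp only [z, DFinsupp.mk_apply]
    split_ifs with hi
    · exact hx i
    · rw [map_zero, eq_comm]
      simpa using hi
  · rintro ⟨x, rfl⟩
    refine DFinsupp.ext fun i => ?_
    exact (hex i).apply_apply_eq_zero (x i)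

end Coproducts

lemma extZero_finsupp {T N : ModuleCat.{u} R} (I : Type u) {n : ℕ} (h : ExtZero T N (n + 1)) :
    ExtZero (ModuleCat.of R (I →₀ T)) N (n + 1) := by
  classical
  let e := finsuppLEquivDirectSum R T I
  exact (extZero_directSum (fun _ : I => T) n N fun _ => h).of_retract_left
    (ModuleCat.ofHom e.toLinearMap) (ModuleCat.ofHom e.symm.toLinearMap) (by ext x : 2; simp)

/-! ### Finite relative projective dimension -/

lemma rpdClass_lt_top_iff {𝒳 𝒴 : Set (ModuleCat.{u} R)} :
    rpdClass 𝒳 𝒴 < ⊤ ↔ ∃ n : ℕ, ∀ Y ∈ 𝒴, ∀ X ∈ 𝒳, ∀ i, n ≤ i → ExtZero Y X (i + 1) := by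
  constructor
  · intro h
    obtain ⟨n, hn⟩ := ENat.ne_top_iff_exists.1 h.ne
    refine ⟨n, fun Y hY X hX i hi => ?_⟩
    have hlt : rpd 𝒳 Y < ((i + 1 : ℕ) : ℕ∞) :=
      (le_iSup (fun Y : 𝒴 => rpd 𝒳 Y) ⟨Y, hY⟩).trans_lt
        (by change rpdClass 𝒳 𝒴 < _; rw [← hn]; exact_mod_cast Nat.lt_succ_of_le hi)
    obtain ⟨m, hm, hmi⟩ := sInf_lt_iff.1 hlt
    exact hm _ hmi X hX
  · rintro ⟨n, h⟩
    refine (iSup_le fun Y => sInf_le ?_ : rpdClass 𝒳 𝒴 ≤ n).trans_lt (ENat.natCast_lt_top n)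
    intro j hj X hX
    obtain ⟨i, rfl⟩ := Nat.exists_eq_succ_of_ne_zero (n := j) (by rintro rfl; simp at hj)
    exact h Y Y.2 X hX i (by simpa [Nat.lt_succ_iff] using (Nat.cast_lt (α := ℕ∞)).1 hj)

lemma pdClass_lt_top_iff {𝒴 : Set (ModuleCat.{u} R)} :
    pdClass 𝒴 < ⊤ ↔ ∃ n : ℕ, ∀ Y ∈ 𝒴, ∀ X, ∀ i, n ≤ i → ExtZero Y X (i + 1) := by
  change rpdClass Set.univ 𝒴 < ⊤ ↔ _
  simp [rpdClass_lt_top_iff]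

lemma pd_lt_top_iff {M : ModuleCat.{u} R} :
    pd M < ⊤ ↔ ∃ n : ℕ, ∀ X, ∀ i, n ≤ i → ExtZero M X (i + 1) := by
  have h : pdClass {M} = pd M := by simp [pdClass]
  simpa [h] using pdClass_lt_top_iff (𝒴 := {M})

/-! ### The class `T^⊥` of a tilting module -/

lemma HasCoresLen.mono {𝒳 𝒴 : Set (ModuleCat.{u} R)} (h : 𝒳 ⊆ 𝒴) (n : ℕ) :
    ∀ M, HasCoresLen 𝒳 n M → HasCoresLen 𝒴 n M := by
  induction n with
  | zero => exact fun M hM => h hM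
  | succ n ih =>
    rintro M ⟨X, C, f, g, hX, hS, hC⟩
    exact ⟨X, C, f, g, h hX, hS, ih C hC⟩

lemma mem_rperpAll_iff {T M : ModuleCat.{u} R} : M ∈ rperpAll T ↔ ∀ i, ExtZero T M (i + 1) :=
  ⟨fun h i => h (i + 1) i.succ_pos, fun h i hi => by
    obtain ⟨i, rfl⟩ := Nat.exists_eq_succ_of_ne_zero hi.ne'
    exact h i⟩

lemma mem_addT_of_retract {T M : ModuleCat.{u} R} (s : M ⟶ T) (r : T ⟶ M) (h : s ≫ r = 𝟙 M) :
    M ∈ AddT T :=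
  ⟨PUnit, s ≫ ModuleCat.ofHom (Finsupp.lsingle PUnit.unit),
    ModuleCat.ofHom (Finsupp.lapply PUnit.unit) ≫ r, by
      ext x
      simpa using congr($h x)⟩

lemma addT_subset_of_retract {T M : ModuleCat.{u} R} (s : M ⟶ T) (r : T ⟶ M)
    (h : s ≫ r = 𝟙 M) : AddT M ⊆ AddT T := by
  rintro N ⟨I, a, b, hab⟩
  refine ⟨I, a ≫ ModuleCat.ofHom (Finsupp.mapRange.linearMap s.hom),
    ModuleCat.ofHom (Finsupp.mapRange.linearMap r.hom) ≫ b, ?_⟩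
  have : ModuleCat.ofHom (Finsupp.mapRange.linearMap (α := I) s.hom) ≫
      ModuleCat.ofHom (Finsupp.mapRange.linearMap r.hom) = 𝟙 _ := by
    rw [← ModuleCat.ofHom_comp, ← Finsupp.mapRange.linearMap_comp, ← ModuleCat.hom_comp, h]
    simp
  simp [reassoc_of% this, hab]

lemma extZero_of_mem_addT {T X M : ModuleCat.{u} R} (hX : X ∈ AddT T) {n : ℕ}
    (h : ExtZero T M (n + 1)) : ExtZero X M (n + 1) := by
  obtain ⟨I, s, r, hsr⟩ := hX
  exact (extZero_finsupp I h).of_retract_left s r hsr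

lemma HasCoresLen.extZero {T M : ModuleCat.{u} R} (hM : M ∈ rperpAll T) (n : ℕ) :
    ∀ C, HasCoresLen (AddT T) n C → ∀ i, ExtZero C M (i + 1) := by
  induction n with
  | zero => exact fun C hC i => extZero_of_mem_addT hC (mem_rperpAll_iff.1 hM i)
  | succ n ih =>
    rintro C ⟨X, D, f, g, hX, hS, hD⟩ i
    exact hS.extZero_left₁ (extZero_of_mem_addT hX (mem_rperpAll_iff.1 hM i)) (ih D hD (i + 1))

lemma exists_hom_apply_eq {T M : ModuleCat.{u} R} {n : ℕ}
    (hR : HasCoresLen (AddT T) n (ModuleCat.of R R)) (hM : M ∈ rperpAll T) (m : M) :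
    ∃ (I : Type u) (φ : (I →₀ T) →ₗ[R] M) (x : I →₀ T), φ x = m := by
  have key : ∃ (X : ModuleCat.{u} R) (f : ModuleCat.of R R ⟶ X), X ∈ AddT T ∧
      ∀ a : ModuleCat.of R R ⟶ M, ∃ b : X ⟶ M, f ≫ b = a := by
    cases n with
    | zero => exact ⟨_, 𝟙 _, hR, fun a => ⟨a, by simp⟩⟩
    | succ n =>
      obtain ⟨X, C, f, g, hX, hS, hC⟩ := hR
      exact ⟨X, f, hX, hS.exists_extension (HasCoresLen.extZero hM n C hC 0)⟩
  obtain ⟨X, f, ⟨I, s, r, hsr⟩, hf⟩ := key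
  obtain ⟨b, hb⟩ := hf (ModuleCat.ofHom (LinearMap.toSpanSingleton R M m))
  refine ⟨I, (r ≫ b).hom, (f ≫ s) (1 : R), ?_⟩
  have h : (f ≫ s) ≫ r ≫ b = ModuleCat.ofHom (LinearMap.toSpanSingleton R M m) := by
    rw [Category.assoc, reassoc_of% hsr, hb]
  simpa using congr($h (1 : R))

lemma exists_addT_cover {T M : ModuleCat.{u} R} {n : ℕ}
    (hT : ∀ (I : Type u) (i : ℕ), ExtZero T (ModuleCat.of R (I →₀ T)) (i + 1))
    (hR : HasCoresLen (AddT T) n (ModuleCat.of R R)) (hM : M ∈ rperpAll T) :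
    ∃ (I : Type u) (K : ModuleCat.{u} R) (f : K ⟶ ModuleCat.of R (I →₀ T))
      (g : ModuleCat.of R (I →₀ T) ⟶ M), K ∈ rperpAll T ∧ IsSES f g := by
  classical
  let π : ((T →ₗ[R] M) →₀ T) →ₗ[R] M := Finsupp.lsum ℕ fun h : T →ₗ[R] M => h
  have hπ (h : T →ₗ[R] M) (t : T) : π (Finsupp.single h t) = h t := by simp [π]
  have hsurj : Function.Surjective π := fun m => by
    obtain ⟨I, φ, x, rfl⟩ := exists_hom_apply_eq hR hM m
    change φ x ∈ LinearMap.range π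
    induction x using Finsupp.induction_linear with
    | zero => simp
    | add x y hx hy => rw [map_add]; exact add_mem hx hy
    | single i t => exact ⟨Finsupp.single (φ ∘ₗ Finsupp.lsingle i) t, by simp [hπ]⟩
  have hS := IsSES.of_exact (LinearMap.ker π).subtype π (Submodule.subtype_injective _)
    (LinearMap.exact_subtype_ker_map π) hsurj
  refine ⟨_, ModuleCat.of R (LinearMap.ker π), _, ModuleCat.ofHom π, ?_, hS⟩
  rw [mem_rperpAll_iff]
  rintro (_ | i)
  · refine hS.extZero_one_of_lift (hT _ 0) fun c => ⟨ModuleCat.ofHom (Finsupp.lsingle c.hom), ?_⟩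
    ext t
    exact hπ c.hom t
  · exact hS.extZero_right₁ (mem_rperpAll_iff.1 hM i) (hT _ _)

lemma extZero_of_mem_rperpAll {T X : ModuleCat.{u} R} {n m : ℕ}
    (hT : ∀ (I : Type u) (i : ℕ), ExtZero T (ModuleCat.of R (I →₀ T)) (i + 1))
    (hR : HasCoresLen (AddT T) n (ModuleCat.of R R))
    (hX : ∀ (I : Type u) (i : ℕ), ExtZero X (ModuleCat.of R (I →₀ T)) (i + 1))
    (hpd : ∀ N, ∀ i, m ≤ i → ExtZero X N (i + 1)) {M : ModuleCat.{u} R} (hM : M ∈ rperpAll T)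
    (i : ℕ) : ExtZero X M (i + 1) := by
  have key (k : ℕ) : ∀ M ∈ rperpAll T, ∀ i, m ≤ i + k → ExtZero X M (i + 1) := by
    induction k with
    | zero => exact fun M _ i hi => hpd M i hi
    | succ k ih =>
      intro M hM i hi
      obtain ⟨I, K, f, g, hK, hS⟩ := exists_addT_cover hT hR hM
      exact hS.extZero_right₃ (hX I i) (ih K hK (i + 1) (by lia))
  exact key m M hM i (by lia)

lemma IsTilting.extZero_finsupp_self {T : ModuleCat.{u} R} (hT : IsTilting T) (I : Type u)
    (i : ℕ) : ExtZero T (ModuleCat.of R (I →₀ T)) (i + 1) :=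
  hT.2.1 (i + 1) i.succ_pos I

lemma IsTilting.closedUnderCoproducts_rperpAll {T : ModuleCat.{u} R} (hT : IsTilting T) :
    ClosedUnderCoproducts (rperpAll T) := by
  classical
  intro ι M hM
  obtain ⟨m, hm⟩ := pd_lt_top_iff.1 hT.1
  obtain ⟨n, hR⟩ := hT.2.2
  have key (k : ℕ) : ∀ M : ι → ModuleCat.{u} R, (∀ j, M j ∈ rperpAll T) → ∀ i, m ≤ i + k →
      ExtZero T (ModuleCat.of R (⨁ j, (M j : Type u))) (i + 1) := by
    induction k with
    | zero => exact fun M _ i hi => hm _ i hi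
    | succ k ih =>
      intro M hM i hi
      choose I K f g hK hS using fun j => exists_addT_cover hT.extZero_finsupp_self hR (hM j)
      refine (IsSES.directSum hS).extZero_right₃ ?_ (ih K hK (i + 1) (by lia))
      let e : ((Σ j, I j) →₀ T) ≃ₗ[R] ⨁ j, (I j →₀ T) := sigmaFinsuppLequivDFinsupp R
      exact (hT.extZero_finsupp_self (Σ j, I j) i).of_retract_right
        (ModuleCat.ofHom e.symm.toLinearMap) (ModuleCat.ofHom e.toLinearMap)
        (by rw [← ModuleCat.ofHom_comp]; simp)
  exact mem_rperpAll_iff.2 fun i => key m M hM i (by lia)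

lemma extZero_of_extZero_add {T A : ModuleCat.{u} R}
    (hA : ∀ N ∈ rperpAll T, ∀ i, ExtZero A N (i + 1)) (k : ℕ) :
    ∀ N, (∀ i, ExtZero T N (i + k + 1)) → ∀ i, ExtZero A N (i + k + 1) := by
  induction k with
  | zero => exact fun N hN => hA N (mem_rperpAll_iff.2 hN)
  | succ k ih =>
    intro N hN i
    obtain ⟨E, C, f, g, hE, hS⟩ := exists_injective_ses N
    exact hS.extZero_right₁
      (ih C (fun j => hS.extZero_right₃ (extZero_of_injective _) (hN j)) i)
      (extZero_of_injective _)

/-! ### Cotorsion pairs -/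

section CotorsionPair

variable {𝒜 ℬ : Set (ModuleCat.{u} R)}

lemma IsCotorsionPair.closedUnderCoproducts_left (hcp : IsCotorsionPair 𝒜 ℬ) :
    ClosedUnderCoproducts 𝒜 := fun _ A hA =>
  (hcp.1 _).2 fun N hN => extZero_directSum A 0 N fun i => (hcp.1 _).1 (hA i) N hN

lemma IsCotorsionPair.closedUnderSummands_kernel (hcp : IsCotorsionPair 𝒜 ℬ) :
    ClosedUnderSummands (𝒜 ∩ ℬ) := fun _ _ s r hsr hN =>
  ⟨(hcp.1 _).2 fun X hX => ((hcp.1 _).1 hN.1 X hX).of_retract_left s r hsr,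
    (hcp.2 _).2 fun X hX => ((hcp.2 _).1 hN.2 X hX).of_retract_right s r hsr⟩

lemma IsHereditary.extZero (hher : IsHereditary 𝒜 ℬ) {M N : ModuleCat.{u} R} (hM : M ∈ 𝒜)
    (hN : N ∈ ℬ) (i : ℕ) : ExtZero M N (i + 1) :=
  hher (i + 1) (Nat.succ_le_succ i.zero_le) M hM N hN

lemma HasCoresLen.of_relative_pd (hcp : IsCotorsionPair 𝒜 ℬ) (hcomp : IsComplete 𝒜 ℬ)
    (hher : IsHereditary 𝒜 ℬ) (k : ℕ) :
    ∀ M ∈ 𝒜, (∀ A ∈ 𝒜, ∀ i, k ≤ i → ExtZero A M (i + 1)) → HasCoresLen (𝒜 ∩ ℬ) k M := by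
  induction k with
  | zero => exact fun M hM h => ⟨hM, (hcp.2 M).2 fun A hA => h A hA 0 le_rfl⟩
  | succ k ih =>
    intro M hM h
    obtain ⟨B, C, f, g, hB, hC, hS⟩ := (hcomp M).2
    have hBA : B ∈ 𝒜 := (hcp.1 B).2 fun N hN =>
      hS.extZero_left₂ (n := 0) ((hcp.1 M).1 hM N hN) ((hcp.1 C).1 hC N hN)
    exact ⟨B, C, f, g, ⟨hBA, hB⟩, hS, ih C hC fun A hA i hi =>
      hS.extZero_right₃ (hher.extZero hA hB i) (h A hA (i + 1) (by lia))⟩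

lemma extZero_of_relative_pd (hcomp : IsComplete 𝒜 ℬ) (hher : IsHereditary 𝒜 ℬ) {n : ℕ}
    {M : ModuleCat.{u} R} (hM : M ∈ 𝒜)
    (h : ∀ A ∈ 𝒜, ∀ i, n ≤ i → ExtZero M A (i + 1)) (N : ModuleCat.{u} R) (i : ℕ) (hi : n ≤ i) :
    ExtZero M N (i + 1) := by
  obtain ⟨B, A, f, g, hB, hA, hS⟩ := (hcomp N).1
  exact hS.extZero_right₃ (h A hA i hi) (hher.extZero hM hB _)

lemma HasCoresLen.extZero_of_pd {ω : Set (ModuleCat.{u} R)} {n : ℕ}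
    (h : ∀ W ∈ ω, ∀ N, ∀ i, n ≤ i → ExtZero W N (i + 1)) (k : ℕ) :
    ∀ M, HasCoresLen ω k M → ∀ N, ∀ i, n ≤ i → ExtZero M N (i + 1) := by
  induction k with
  | zero => exact h
  | succ k ih =>
    rintro M ⟨W, C, f, g, hW, hS, hC⟩ N i hi
    exact hS.extZero_left₁ (h W hW N i hi) (ih C hC N (i + 1) (by lia))

lemma HasCoresLen.exists_addT {ω : Set (ModuleCat.{u} R)} (hω : ClosedUnderCoproducts ω) (k : ℕ) :
    ∀ M, HasCoresLen ω k M → ∃ T ∈ ω, HasCoresLen (AddT T) k M := by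
  classical
  induction k with
  | zero => exact fun M hM => ⟨M, hM, mem_addT_of_retract (𝟙 M) (𝟙 M) (by simp)⟩
  | succ k ih =>
    rintro M ⟨W, C, f, g, hW, hS, hC⟩
    obtain ⟨T, hT, hCT⟩ := ih C hC
    let F : ULift.{u} Bool → ModuleCat.{u} R := fun b => if b.down then W else T
    let s (b : ULift.{u} Bool) : F b ⟶ ModuleCat.of R (⨁ b, (F b : Type u)) :=
      ModuleCat.ofHom (DirectSum.lof R _ (fun b => (F b : Type u)) b)
    let r (b : ULift.{u} Bool) : ModuleCat.of R (⨁ b, (F b : Type u)) ⟶ F b :=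
      ModuleCat.ofHom (DirectSum.component R _ (fun b => (F b : Type u)) b)
    have hsr (b : ULift.{u} Bool) : s b ≫ r b = 𝟙 (F b) := by
      ext x
      exact DirectSum.component.lof_self R (M := fun b => (F b : Type u)) b x
    refine ⟨ModuleCat.of R (⨁ b, (F b : Type u)), hω _ F ?_, W, C, f, g,
      mem_addT_of_retract (s ⟨true⟩) (r ⟨true⟩) (hsr ⟨true⟩), hS,
      HasCoresLen.mono (addT_subset_of_retract (s ⟨false⟩) (r ⟨false⟩) (hsr ⟨false⟩)) k C hCT⟩
    rintro ⟨_ | _⟩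
    exacts [hT, hW]

lemma IsTilting.rpdClass_lt_top (hher : IsHereditary 𝒜 ℬ) {T : ModuleCat.{u} R}
    (hT : IsTilting T) (hℬ : ℬ = rperpAll T) : rpdClass 𝒜 𝒜 < ⊤ := by
  obtain ⟨n, hn⟩ := pd_lt_top_iff.1 hT.1
  refine rpdClass_lt_top_iff.2 ⟨n, fun A hA X _ i hi => ?_⟩
  obtain ⟨j, rfl⟩ := Nat.exists_eq_add_of_le' hi
  exact extZero_of_extZero_add (fun N hN => hher.extZero hA (hℬ ▸ hN)) n X
    (fun i => hn X _ (by lia)) j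

lemma IsTilting.closedUnderCoproducts_kernel (hcp : IsCotorsionPair 𝒜 ℬ) {T : ModuleCat.{u} R}
    (hT : IsTilting T) (hℬ : ℬ = rperpAll T) : ClosedUnderCoproducts (𝒜 ∩ ℬ) := by
  intro I f hf
  refine ⟨hcp.closedUnderCoproducts_left I f fun i => (hf i).1, ?_⟩
  subst hℬ
  exact hT.closedUnderCoproducts_rperpAll I f fun i => (hf i).2

lemma exists_isTilting (hcp : IsCotorsionPair 𝒜 ℬ) (hher : IsHereditary 𝒜 ℬ)
    (hω : ClosedUnderCoproducts (𝒜 ∩ ℬ)) (hpd : pdClass (𝒜 ∩ ℬ) < ⊤)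
    (hcores : 𝒜 ⊆ coresClosure (𝒜 ∩ ℬ)) :
    ∃ T : ModuleCat.{u} R, IsTilting T ∧ ℬ = rperpAll T := by
  classical
  obtain ⟨n, hn⟩ := pdClass_lt_top_iff.1 hpd
  have : Projective (ModuleCat.of R R) :=
    (IsProjective.iff_projective (R := R) (ModuleCat.of R R)).1 (Module.Projective.of_free)
  obtain ⟨k, hk⟩ := hcores ((hcp.1 (ModuleCat.of R R)).2 fun _ _ => extZero_of_projective 0)
  obtain ⟨T, hTω, hR⟩ := HasCoresLen.exists_addT hω k _ hk
  have hsum (I : Type u) : ModuleCat.of R (I →₀ T) ∈ 𝒜 ∩ ℬ := by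
    let e := finsuppLEquivDirectSum R T I
    exact hcp.closedUnderSummands_kernel _ _ (ModuleCat.ofHom e.toLinearMap)
      (ModuleCat.ofHom e.symm.toLinearMap) (by ext x : 2; simp) (hω I (fun _ => T) fun _ => hTω)
  have hself (A : ModuleCat.{u} R) (hA : A ∈ 𝒜) (I : Type u) (i : ℕ) :
      ExtZero A (ModuleCat.of R (I →₀ T)) (i + 1) := hher.extZero hA (hsum I).2 i
  refine ⟨T, ⟨pd_lt_top_iff.2 ⟨n, hn T hTω⟩, fun i hi I => hher i hi T hTω.1 _ (hsum I).2,
    k, hR⟩, Set.Subset.antisymm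
      (fun N hN => mem_rperpAll_iff.2 fun i => hher.extZero hTω.1 hN i) fun N hN => ?_⟩
  refine (hcp.2 N).2 fun A hA => ?_
  obtain ⟨l, hl⟩ := hcores hA
  exact extZero_of_mem_rperpAll (hself T hTω.1) hR (hself A hA)
    (HasCoresLen.extZero_of_pd hn l A hl) hN 0

end CotorsionPair

/-- Theorem 3.2(a): characterization of tilting cotorsion pairs. -/
theorem stmt9 {R : Type u} [Ring R] (𝒜 ℬ ω : Set (ModuleCat.{u} R))
    (hcp : IsCotorsionPair 𝒜 ℬ) (hcomp : IsComplete 𝒜 ℬ) (hher : IsHereditary 𝒜 ℬ)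
    (hω : ω = 𝒜 ∩ ℬ) :
    ((∃ T : ModuleCat.{u} R, IsTilting T ∧ ℬ = rperpAll T) ↔
      (rpdClass 𝒜 𝒜 < ⊤ ∧ ClosedUnderCoproducts ω)) ∧
    ((∃ T : ModuleCat.{u} R, IsTilting T ∧ ℬ = rperpAll T) ↔
      (ClosedUnderCoproducts ω ∧ pdClass ω < ⊤ ∧ 𝒜 ⊆ coresClosure ω)) := by
  subst hω
  have h₁ : (∃ T : ModuleCat.{u} R, IsTilting T ∧ ℬ = rperpAll T) →
      rpdClass 𝒜 𝒜 < ⊤ ∧ ClosedUnderCoproducts (𝒜 ∩ ℬ) := by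
    rintro ⟨T, hT, hℬ⟩
    exact ⟨hT.rpdClass_lt_top hher hℬ, hT.closedUnderCoproducts_kernel hcp hℬ⟩
  have h₂ : (rpdClass 𝒜 𝒜 < ⊤ ∧ ClosedUnderCoproducts (𝒜 ∩ ℬ)) →
      ClosedUnderCoproducts (𝒜 ∩ ℬ) ∧ pdClass (𝒜 ∩ ℬ) < ⊤ ∧ 𝒜 ⊆ coresClosure (𝒜 ∩ ℬ) := by
    rintro ⟨hpd, hsum⟩
    obtain ⟨n, hn⟩ := rpdClass_lt_top_iff.1 hpd
    exact ⟨hsum, pdClass_lt_top_iff.2 ⟨n, fun W hW =>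
        extZero_of_relative_pd hcomp hher hW.1 (hn W hW.1)⟩,
      fun A hA => ⟨n, HasCoresLen.of_relative_pd hcp hcomp hher n A hA
        fun A' hA' => hn A' hA' A hA⟩⟩
  have h₃ : ClosedUnderCoproducts (𝒜 ∩ ℬ) ∧ pdClass (𝒜 ∩ ℬ) < ⊤ ∧ 𝒜 ⊆ coresClosure (𝒜 ∩ ℬ) →
      ∃ T : ModuleCat.{u} R, IsTilting T ∧ ℬ = rperpAll T := fun h =>
    exists_isTilting hcp hher h.1 h.2.1 h.2.2
  exact ⟨⟨h₁, h₃ ∘ h₂⟩, ⟨h₂ ∘ h₁, h₃⟩⟩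

end CotorsionDim
end
end

section
/- Let R be an associative ring with unit and let (A, B) be a complete cotorsion pair in Mod R. Then for any right R-module M: id M = max{id_A(M), id_B(M)} and pd M = max{pd_A(M), pd_B(M)}, where id M and pd M are the usual injective and projective dimensions. -/
noncomputable section

open CategoryTheory CategoryTheory.Limits Opposite DirectSum

universe u

namespace CotorsionDim

variable {R : Type u} [Ring R]

variable (R)

variable {R}

variable (R)

variable {R}

lemma extZero_succ_iff_subsingleton (M N : ModuleCat.{u} R) (n : ℕ) :
    ExtZero M N (n + 1) ↔ Subsingleton (Abelian.Ext.{u} M N (n + 1)) := by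
  let P := projectiveResolution M
  rw [ExtZero, (P.isoExt (R := ℤ) (n + 1) N).isZero_iff,
    ← HomologicalComplex.exactAt_iff_isZero_homology,
    HomologicalComplex.exactAt_iff' _ n (n + 1) (n + 2) (by simp) (by simp),
    ShortComplex.moduleCat_exact_iff]
  constructor
  · intro h
    refine subsingleton_of_forall_eq 0 fun α => ?_
    obtain ⟨f, hf, rfl⟩ := P.extMk_surjective α (n + 2) rfl
    rw [P.extMk_eq_zero_iff f _ rfl hf n rfl]
    exact h f hf
  · intro h (f : P.complex.X (n + 1) ⟶ N) hf
    exact (P.extMk_eq_zero_iff f (n + 2) rfl hf n rfl).1 (Subsingleton.elim _ _)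

lemma ExtZero.of_shortExact_left {X Y Z : ModuleCat.{u} R} {f : X ⟶ Y} {g : Y ⟶ Z}
    (h : IsSES f g) (M : ModuleCat.{u} R) (n : ℕ)
    (hY : ExtZero Y M (n + 1)) (hZ : ExtZero Z M (n + 2)) : ExtZero X M (n + 1) := by
  obtain ⟨w, hS⟩ := h
  rw [extZero_succ_iff_subsingleton] at hY hZ ⊢
  refine subsingleton_of_forall_eq 0 fun x => ?_
  obtain ⟨y, rfl⟩ := Abelian.Ext.contravariant_sequence_exact₁ hS M x
    (n₁ := n + 2) (by omega) (Subsingleton.elim _ _)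
  rw [Subsingleton.elim y 0, Abelian.Ext.comp_zero]

lemma ExtZero.of_shortExact_right {X Y Z : ModuleCat.{u} R} {f : X ⟶ Y} {g : Y ⟶ Z}
    (h : IsSES f g) (M : ModuleCat.{u} R) (n : ℕ)
    (hY : ExtZero M Y (n + 1)) (hX : ExtZero M X (n + 2)) : ExtZero M Z (n + 1) := by
  obtain ⟨w, hS⟩ := h
  rw [extZero_succ_iff_subsingleton] at hY hX ⊢
  refine subsingleton_of_forall_eq 0 fun x => ?_
  obtain ⟨y, rfl⟩ := Abelian.Ext.covariant_sequence_exact₃ M hS x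
    (n₁ := n + 2) (by omega) (Subsingleton.elim _ _)
  rw [Subsingleton.elim y 0, Abelian.Ext.zero_comp]

/-- The infimum of the bounds beyond which `p` holds is itself such a bound. -/
lemma sInf_bounds_le_iff (p : ℕ → Prop) (m : ℕ∞) :
    sInf {n : ℕ∞ | ∀ j : ℕ, n < (j : ℕ∞) → p j} ≤ m ↔ ∀ j : ℕ, m < (j : ℕ∞) → p j := by
  refine ⟨fun h j hj => ?_, fun h => sInf_le h⟩
  obtain ⟨n, hn, hnj⟩ := sInf_lt_iff.1 (h.trans_lt hj)
  exact hn j hnj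

lemma rpd_le_iff {𝒳 : Set (ModuleCat.{u} R)} {M : ModuleCat.{u} R} {m : ℕ∞} :
    rpd 𝒳 M ≤ m ↔ ∀ j : ℕ, m < (j : ℕ∞) → ∀ X ∈ 𝒳, ExtZero M X j :=
  sInf_bounds_le_iff _ m

lemma rid_le_iff {𝒳 : Set (ModuleCat.{u} R)} {M : ModuleCat.{u} R} {m : ℕ∞} :
    rid 𝒳 M ≤ m ↔ ∀ j : ℕ, m < (j : ℕ∞) → ∀ X ∈ 𝒳, ExtZero X M j :=
  sInf_bounds_le_iff _ m

lemma rpd_mono {𝒳 𝒴 : Set (ModuleCat.{u} R)} (h : 𝒳 ⊆ 𝒴) (M : ModuleCat.{u} R) :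
    rpd 𝒳 M ≤ rpd 𝒴 M :=
  rpd_le_iff.2 fun j hj X hX => rpd_le_iff.1 le_rfl j hj X (h hX)

lemma rid_mono {𝒳 𝒴 : Set (ModuleCat.{u} R)} (h : 𝒳 ⊆ 𝒴) (M : ModuleCat.{u} R) :
    rid 𝒳 M ≤ rid 𝒴 M :=
  rid_le_iff.2 fun j hj X hX => rid_le_iff.1 le_rfl j hj X (h hX)

/-- Theorem 2.2(a): for a complete cotorsion pair,
`id M = max(id_𝒜 M, id_ℬ M)` and `pd M = max(pd_𝒜 M, pd_ℬ M)`. -/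
theorem stmt12 {R : Type u} [Ring R] (𝒜 ℬ : Set (ModuleCat.{u} R))
    (hcp : IsCotorsionPair 𝒜 ℬ) (hcomp : IsComplete 𝒜 ℬ) (M : ModuleCat.{u} R) :
    idim M = max (rid 𝒜 M) (rid ℬ M) ∧
    pd M = max (rpd 𝒜 M) (rpd ℬ M) := by
  refine ⟨le_antisymm (rid_le_iff.2 fun j hj N _ => ?_)
      (max_le (rid_mono (Set.subset_univ _) M) (rid_mono (Set.subset_univ _) M)),
    le_antisymm (rpd_le_iff.2 fun j hj N _ => ?_)
      (max_le (rpd_mono (Set.subset_univ _) M) (rpd_mono (Set.subset_univ _) M))⟩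
  all_goals
    obtain ⟨n, rfl⟩ := Nat.exists_eq_add_one_of_ne_zero
      (show j ≠ 0 by rintro rfl; simp at hj)
    have hj' := hj.trans (b := ((n + 1 : ℕ) : ℕ∞)) (c := ((n + 2 : ℕ) : ℕ∞))
      (by exact_mod_cast Nat.lt_succ_self _)
  · obtain ⟨B, A, f, g, hB, hA, hfg⟩ := (hcomp N).2
    exact .of_shortExact_left hfg M n (rid_le_iff.1 (le_max_right _ _) _ hj B hB)
      (rid_le_iff.1 (le_max_left _ _) _ hj' A hA)
  · obtain ⟨B, A, f, g, hB, hA, hfg⟩ := (hcomp N).1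
    exact .of_shortExact_right hfg M n (rpd_le_iff.1 (le_max_left _ _) _ hj A hA)
      (rpd_le_iff.1 (le_max_right _ _) _ hj' B hB)

end CotorsionDim
end
end
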